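/- Closure invariance of the matroid independence relation: let cl be a finitary matroid on a type α and let ⫫ be the induced independence relation. Then for all A, B, C ⊆ α, A ⫫_C B if and only if cl(A) ⫫_{cl(C)} cl(B). -/

import Mathlib

open Set

/-- A finitary matroid (pregeometry) on `α`: a closure operator satisfying
extension, monotonicity, idempotency, finitary character, and the exchange principle. -/
structure IsFinMatroid {α : Type*} (cl : Set α → Set α) : Prop where
  subset_cl : ∀ X : Set α, X ⊆ cl X
  mono : ∀ ⦃X Y : Set α⦄, X ⊆ Y → cl X ⊆ cl Y
  idem : ∀ X : Set α, cl (cl X) = cl X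
  finitary : ∀ X : Set α, cl X = ⋃ A ∈ {A : Set α | A ⊆ X ∧ A.Finite}, cl A
  exchange : ∀ ⦃X : Set α⦄ ⦃a c : α⦄, a ∈ cl (X ∪ {c}) → a ∉ cl X → c ∈ cl (X ∪ {a})

/-- `ClIndep cl B S` : the set `S` is `cl`-independent over `B`. -/
def ClIndep {α : Type*} (cl : Set α → Set α) (B S : Set α) : Prop :=
  ∀ a ∈ S, a ∉ cl (B ∪ (S \ {a}))

/-- `ClInd cl A B C` means `A ⫫_B C` : every `Z' ⊆ C` that is `cl`-independent over `B`
is also `cl`-independent over `B ∪ A`. -/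
def ClInd {α : Type*} (cl : Set α → Set α) (A B C : Set α) : Prop :=
  ∀ Z' : Set α, Z' ⊆ C → ClIndep cl B Z' → ClIndep cl (B ∪ A) Z'

/-- The relative rank `RK(A/B)`: the supremum of the cardinalities of subsets of `A`
that are `cl`-independent over `B`. -/
noncomputable def ClRK {α : Type*} (cl : Set α → Set α) (A B : Set α) : Cardinal :=
  ⨆ S : {S : Set α // S ⊆ A ∧ ClIndep cl B S}, Cardinal.mk S.1

namespace IsFinMatroid

variable {α : Type*} {cl : Set α → Set α}

theorem cl_subset_cl (hcl : IsFinMatroid cl) {X Y : Set α} (h : X ⊆ cl Y) : cl X ⊆ cl Y := by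
  simpa [hcl.idem] using hcl.mono h

theorem cl_union_congr (hcl : IsFinMatroid cl) {X X' : Set α} (h : cl X = cl X') (Y : Set α) :
    cl (X ∪ Y) = cl (X' ∪ Y) := by
  have key : ∀ {U V : Set α}, cl U = cl V → cl (U ∪ Y) ⊆ cl (V ∪ Y) := fun {U V} hUV =>
    hcl.cl_subset_cl <| union_subset
      ((hcl.subset_cl U).trans <| hUV.trans_subset <| hcl.mono subset_union_left)
      (subset_union_right.trans <| hcl.subset_cl _)
  exact (key h).antisymm (key h.symm)

theorem cl_union_cl (hcl : IsFinMatroid cl) (X Y : Set α) :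
    cl (cl X ∪ cl Y) = cl (X ∪ Y) := by
  rw [hcl.cl_union_congr (hcl.idem X), union_comm, hcl.cl_union_congr (hcl.idem Y), union_comm]

theorem clIndep_congr (hcl : IsFinMatroid cl) {X X' : Set α} (h : cl X = cl X') (S : Set α) :
    ClIndep cl X S ↔ ClIndep cl X' S := by
  simp only [ClIndep, hcl.cl_union_congr h]

theorem exists_finset_mem_cl_union (hcl : IsFinMatroid cl) {X Y : Set α} {a : α}
    (ha : a ∈ cl (X ∪ Y)) : ∃ F : Finset α, (F : Set α) ⊆ Y ∧ a ∈ cl (X ∪ F) := by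
  rw [hcl.finitary] at ha
  simp only [mem_ofPred_eq, mem_iUnion, exists_prop] at ha
  obtain ⟨T, ⟨hT, hfin⟩, haT⟩ := ha
  have hTY : (T ∩ Y).Finite := hfin.subset inter_subset_left
  refine ⟨hTY.toFinset, by simp, hcl.mono (fun x hx => ?_) haT⟩
  rw [hTY.coe_toFinset]
  exact (hT hx).imp id fun hxY => ⟨hx, hxY⟩

/-- Symmetry of the independence relation induced by a finitary matroid. -/
theorem clInd_symm (hcl : IsFinMatroid cl) {A B C : Set α} (h : ClInd cl A C B) :
    ClInd cl B C A := by
  intro Z hZA hZ z hz hzB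
  rw [union_right_comm] at hzB
  obtain ⟨F₀, hF₀⟩ := hcl.exists_finset_mem_cl_union hzB
  obtain ⟨F, hF⟩ := exists_minimal_of_wellFoundedLT
    (fun F : Finset α => (F : Set α) ⊆ B ∧ z ∈ cl (C ∪ Z \ {z} ∪ F)) ⟨F₀, hF₀⟩
  obtain ⟨hFB, hzF⟩ := hF.prop
  have hmin : ∀ b ∈ F, z ∉ cl (C ∪ Z \ {z} ∪ ((F : Set α) \ {b})) := by
    classical
    intro b hb hzb
    have hlt := Finset.erase_ssubset hb
    refine hF.not_prop_of_lt hlt ⟨?_, by rwa [Finset.coe_erase]⟩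
    exact (Finset.coe_subset.2 hlt.subset).trans hFB
  have hFC : ClIndep cl C F := by
    intro b hb hbC
    refine hmin b hb (hcl.cl_subset_cl (fun x hx => ?_) hzF)
    by_cases hxb : x = b
    · subst hxb
      exact hcl.mono (union_subset_union_left _ subset_union_left) hbC
    · exact hcl.subset_cl _ (hx.imp id fun hxF => ⟨hxF, hxb⟩)
  obtain ⟨b, hb⟩ : F.Nonempty := by
    rw [Finset.nonempty_iff_ne_empty]
    rintro rfl
    exact hZ z hz (by simpa using hzF)
  refine h F hFB hFC b hb (hcl.mono ?_ (hcl.exchange (c := b) ?_ (hmin b hb)))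
  · rintro x (((hx | hx) | hx) | rfl)
    · exact .inl (.inl hx)
    · exact .inl (.inr (hZA hx.1))
    · exact .inr hx
    · exact .inl (.inr (hZA hz))
  · refine hcl.mono (fun x hx => ?_) hzF
    by_cases hxb : x = b
    · exact .inr hxb
    · exact .inl (hx.imp id fun hxF => ⟨hxF, hxb⟩)

theorem clInd_congr (hcl : IsFinMatroid cl) {A A' C C' : Set α} (hA : cl A = cl A')
    (hC : cl C = cl C') (B : Set α) : ClInd cl A C B ↔ ClInd cl A' C' B := by
  have hCA : cl (C ∪ A) = cl (C' ∪ A') := by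
    rw [← hcl.cl_union_cl, hA, hC, hcl.cl_union_cl]
  simp only [ClInd, hcl.clIndep_congr hC, hcl.clIndep_congr hCA]

end IsFinMatroid

/-- Closure invariance of the matroid independence relation:
`A ⫫_C B` if and only if `cl(A) ⫫_{cl(C)} cl(B)`. -/
theorem clInd_closure_iff {α : Type*} {cl : Set α → Set α} (hcl : IsFinMatroid cl)
    (A B C : Set α) :
    ClInd cl A C B ↔ ClInd cl (cl A) (cl C) (cl B) := by
  have symm_iff : ∀ X Y : Set α, ClInd cl X C Y ↔ ClInd cl Y C X := fun _ _ =>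
    ⟨hcl.clInd_symm, hcl.clInd_symm⟩
  rw [hcl.clInd_congr (hcl.idem A) (hcl.idem C), symm_iff A (cl B),
    hcl.clInd_congr (hcl.idem B) rfl, symm_iff B A]
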